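/- arXiv:1706.03682 — 4 statements merged into one kernel-verified Lean document; each statement's English description precedes it below -/
import Mathlib

section
/- For any pair of finite simple graphs G and H, the domination number of their Cartesian product satisfies γ(G □ H) ≥ (1/2)·γ(G)·γ(H) + (1/2)·min(γ(G), γ(H)). -/
open SimpleGraph

/-- `D` is a dominating set of `G`: every vertex lies in the closed
neighborhood of some vertex of `D`. -/
def IsDominating {V : Type*} (G : SimpleGraph V) (D : Set V) : Prop :=
  ∀ v : V, ∃ d ∈ D, v = d ∨ G.Adj d v

/-- The domination number of a finite graph: the minimum cardinality of a
dominating set. -/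
noncomputable def dominationNumber (V : Type*) [Fintype V] (G : SimpleGraph V) : ℕ :=
  sInf {n : ℕ | ∃ D : Finset V, IsDominating G ↑D ∧ D.card = n}

/-- The closed neighborhood `N_G[P]` of a set of vertices `P`. -/
def closedNbhd {V : Type*} (G : SimpleGraph V) (P : Set V) : Set V :=
  ⋃ p ∈ P, insert p (G.neighborSet p)

theorem dominationNumber_le_card {V : Type*} [Fintype V] {G : SimpleGraph V} {D : Finset V}
    (hD : IsDominating G ↑D) : dominationNumber V G ≤ D.card :=
  Nat.sInf_le ⟨D, hD, rfl⟩

theorem exists_isDominating_card_eq (V : Type*) [Fintype V] (G : SimpleGraph V) :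
    ∃ D : Finset V, IsDominating G ↑D ∧ D.card = dominationNumber V G :=
  Nat.sInf_mem (s := {n : ℕ | ∃ D : Finset V, IsDominating G ↑D ∧ D.card = n})
    ⟨_, Finset.univ, fun v => ⟨v, by simp, Or.inl rfl⟩, rfl⟩

/-- A dominating set `U` induces a map sending each vertex to a vertex of `U` that dominates it,
and fixing `U` pointwise. -/
theorem IsDominating.exists_retraction {V : Type*} {G : SimpleGraph V} {U : Set V}
    (hU : IsDominating G U) :
    ∃ f : V → V, (∀ v, f v ∈ U) ∧ (∀ v, v = f v ∨ G.Adj (f v) v) ∧ ∀ u ∈ U, f u = u := by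
  have h : ∀ v, ∃ d, d ∈ U ∧ (v = d ∨ G.Adj d v) ∧ (v ∈ U → d = v) := by
    intro v
    by_cases hv : v ∈ U
    · exact ⟨v, hv, Or.inl rfl, fun _ => rfl⟩
    · obtain ⟨d, hd, h⟩ := hU v
      exact ⟨d, hd, h, fun h => absurd h hv⟩
  choose f hf using h
  exact ⟨f, fun v => (hf v).1, fun v => (hf v).2.1, fun u hu => (hf u).2.2 hu⟩

theorem IsDominating.image_fst {V W : Type*} [Nonempty W] [DecidableEq V] {G : SimpleGraph V}
    {H : SimpleGraph W} {D : Finset (V × W)} (hD : IsDominating (G □ H) ↑D) :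
    IsDominating G ↑(D.image Prod.fst) := by
  intro v
  obtain ⟨⟨a, b⟩, hd, h⟩ := hD (v, Classical.arbitrary W)
  refine ⟨a, by simpa using ⟨b, hd⟩, ?_⟩
  simp only [Prod.mk.injEq, boxProd_adj] at h
  grind

open Classical in
/-- The bound comes from counting, in two ways, the pairs `(u, w)` for which no vertex of `D`
dominates the fiber of `u` at height `w` vertically. The dominating set `U` of `G` is chosen of
minimum size within the projection of `D`. -/
theorem dominationNumber_mul_succ_le {V W : Type*} [Fintype V] [Fintype W] [Nonempty W]
    (G : SimpleGraph V) (H : SimpleGraph W) :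
    dominationNumber V G * (dominationNumber W H + 1) ≤
      2 * dominationNumber (V × W) (G □ H) := by
  obtain ⟨D, hD, hDcard⟩ := exists_isDominating_card_eq (V × W) (G □ H)
  rw [← hDcard]
  obtain ⟨U, hU, hUmin⟩ := Finset.exists_min_image
    ((D.image Prod.fst).powerset.filter fun S : Finset V => IsDominating G ↑S) Finset.card
    ⟨D.image Prod.fst, by simpa using hD.image_fst⟩
  simp only [Finset.mem_filter, Finset.mem_powerset] at hU hUmin
  obtain ⟨hUsub, hUdom⟩ := hU
  obtain ⟨f, hfU, hfdom, hfix⟩ := hUdom.exists_retraction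
  simp only [Finset.mem_coe] at hfU hfix
  set cov : V → W → Prop := fun u w => ∃ p ∈ D, f p.1 = u ∧ (w = p.2 ∨ H.Adj p.2 w)
  have row : ∀ w, (U.filter fun u => ¬ cov u w).card + (U.filter fun u => (u, w) ∈ D).card ≤
      (D.filter fun p => p.2 = w).card := by
    intro w
    set Dw := (D.filter fun p => p.2 = w).image Prod.fst with hDw
    set T := U.filter fun u => cov u w with hT
    have hdom : IsDominating G ↑(Dw ∪ T) := by
      intro g
      by_cases hg : cov (f g) w
      · exact ⟨f g, by simp [hT, hfU, hg], hfdom g⟩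
      · obtain ⟨⟨a, b⟩, hd, h⟩ := hD (g, w)
        simp only [Prod.mk.injEq, boxProd_adj] at h
        have hvert : ¬ (a = g ∧ (w = b ∨ H.Adj b w)) := by
          rintro ⟨rfl, hwb⟩
          exact hg ⟨(a, b), hd, rfl, hwb⟩
        have hb : b = w ∧ G.Adj a g := by grind
        refine ⟨a, ?_, Or.inr hb.2⟩
        have : (a, w) ∈ D := hb.1 ▸ hd
        simp [hDw, this]
    have hsub : Dw ∪ T ⊆ D.image Prod.fst := by
      refine Finset.union_subset (Finset.image_subset_image (Finset.filter_subset _ _)) ?_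
      exact (Finset.filter_subset _ _).trans hUsub
    have hmin := hUmin _ ⟨hsub, hdom⟩
    have hinter : (U.filter fun u => (u, w) ∈ D) ⊆ Dw ∩ T := by
      intro u hu
      simp only [Finset.mem_filter] at hu
      have : cov u w := ⟨(u, w), hu.2, hfix u hu.1, Or.inl rfl⟩
      simp [hDw, hT, hu, this]
    have h1 := Finset.card_le_card hinter
    have h2 := Finset.card_union_add_card_inter Dw T
    have h3 : Dw.card ≤ (D.filter fun p => p.2 = w).card := Finset.card_image_le
    have h4 : T.card + (U.filter fun u => ¬ cov u w).card = U.card :=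
      Finset.card_filter_add_card_filter_not _
    omega
  have column : ∀ u, dominationNumber W H ≤
      (D.filter fun p => f p.1 = u).card + (Finset.univ.filter fun w => ¬ cov u w).card := by
    intro u
    have hdom : IsDominating H ↑((D.filter fun p => f p.1 = u).image Prod.snd ∪
        Finset.univ.filter fun w => ¬ cov u w) := by
      intro w
      by_cases hw : cov u w
      · obtain ⟨⟨a, b⟩, hp, hpu, h⟩ := hw
        refine ⟨b, ?_, h⟩
        simp only [Finset.coe_union, Set.mem_union, Finset.mem_coe, Finset.mem_image]
        exact Or.inl ⟨(a, b), by simpa using ⟨hp, hpu⟩, rfl⟩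
      · exact ⟨w, by simp [hw], Or.inl rfl⟩
    refine (dominationNumber_le_card hdom).trans ((Finset.card_union_le _ _).trans ?_)
    gcongr
    exact Finset.card_image_le
  have hUcard : U.card ≤ ∑ w : W, (U.filter fun u => (u, w) ∈ D).card := by
    refine (Finset.card_le_card fun u hu => ?_).trans Finset.card_biUnion_le
    obtain ⟨p, hp, rfl⟩ := Finset.mem_image.mp (hUsub hu)
    exact Finset.mem_biUnion.mpr ⟨p.2, Finset.mem_univ _, by simp [hu, hp]⟩
  have hrows := Finset.sum_le_sum fun w (_ : w ∈ Finset.univ) => row w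
  have hcolumns := Finset.sum_le_sum fun u (_ : u ∈ U) => column u
  have hDrows : D.card = ∑ w : W, (D.filter fun p => p.2 = w).card :=
    Finset.card_eq_sum_card_fiberwise fun _ _ => Finset.mem_univ _
  have hDcolumns : D.card = ∑ u ∈ U, (D.filter fun p => f p.1 = u).card :=
    Finset.card_eq_sum_card_fiberwise fun p _ => hfU p.1
  have hcount : ∑ u ∈ U, (Finset.univ.filter fun w => ¬ cov u w).card =
      ∑ w : W, (U.filter fun u => ¬ cov u w).card :=
    Finset.sum_card_bipartiteAbove_eq_sum_card_bipartiteBelow fun u w => ¬ cov u w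
  rw [Finset.sum_add_distrib] at hrows hcolumns
  rw [Finset.sum_const, smul_eq_mul] at hcolumns
  have hmul : dominationNumber V G * (dominationNumber W H + 1) ≤
      U.card * (dominationNumber W H + 1) :=
    Nat.mul_le_mul_right _ (dominationNumber_le_card hUdom)
  rw [mul_add_one U.card] at hmul
  omega

theorem vizing_half_plus_min {V W : Type*} [Fintype V] [Fintype W]
    (G : SimpleGraph V) (H : SimpleGraph W) :
    (dominationNumber (V × W) (G □ H) : ℝ) ≥
      (1 / 2) * (dominationNumber V G) * (dominationNumber W H) +
        (1 / 2) * min (dominationNumber V G) (dominationNumber W H) := by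
  rcases isEmpty_or_nonempty W with hW | hW
  · have h : dominationNumber W H = 0 :=
      Nat.le_zero.mp (dominationNumber_le_card (D := ∅) fun w => isEmptyElim w)
    simp [h]
  · have h : (dominationNumber V G : ℝ) * (dominationNumber W H + 1) ≤
        2 * dominationNumber (V × W) (G □ H) := by
      exact_mod_cast dominationNumber_mul_succ_le G H
    have hmin := min_le_left (dominationNumber V G : ℝ) (dominationNumber W H)
    rw [Nat.cast_min]
    linarith
end

section
/- Let G be a finite simple graph, let Q ⊆ V(G) be a dominating set of G, and let U = {u_1, …, u_k} ⊆ Q be a dominating set of G of minimum cardinality among all dominating subsets of Q. Let π_1, …, π_k be a partition of V(G) such that u_i ∈ π_i and π_i ⊆ N_G[u_i] for every i. Then for every subset A ⊆ Q, the number of indices i ∈ {1, …, k} with π_i ⊆ N_G[A] is at most |A|, where N_G[A] = ⋃_{a ∈ A} N_G[a]. -/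
open SimpleGraph

theorem few_cells_dominated {V : Type*} [Fintype V] (G : SimpleGraph V)
    (Q : Set V) (hQ : IsDominating G Q)
    (k : ℕ) (u : Fin k → V) (hinj : Function.Injective u)
    (huQ : Set.range u ⊆ Q) (hUdom : IsDominating G (Set.range u))
    (hmin : ∀ U' : Finset V, ↑U' ⊆ Q → IsDominating G ↑U' → k ≤ U'.card)
    (π : Fin k → Set V)
    (hmem : ∀ i, u i ∈ π i) (hsub : ∀ i, π i ⊆ closedNbhd G {u i})
    (hdisj : Pairwise (Function.onFun Disjoint π))
    (hcover : (⋃ i, π i) = Set.univ)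
    (A : Finset V) (hA : ↑A ⊆ Q) :
    {i : Fin k | π i ⊆ closedNbhd G ↑A}.ncard ≤ A.card := by
  classical
  let S : Finset (Fin k) := Finset.univ.filter fun i => π i ⊆ closedNbhd G ↑A
  have hS : {i : Fin k | π i ⊆ closedNbhd G ↑A} = ↑S := by
    ext i
    simp [S]
  rw [hS, Set.ncard_coe_finset]
  have hsubQ : ↑(A ∪ Sᶜ.image u) ⊆ Q := by
    intro v hv
    rcases Finset.mem_union.1 (Finset.mem_coe.1 hv) with h | h
    · exact hA h
    · obtain ⟨i, -, rfl⟩ := Finset.mem_image.1 h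
      exact huQ ⟨i, rfl⟩
  have hdom : IsDominating G ↑(A ∪ Sᶜ.image u) := by
    intro v
    obtain ⟨i, hi⟩ := Set.mem_iUnion.1 (hcover ▸ Set.mem_univ v)
    by_cases h : i ∈ S
    · have hv := (Finset.mem_filter.1 h).2 hi
      simp only [closedNbhd, Set.mem_iUnion] at hv
      obtain ⟨a, ha, hav⟩ := hv
      exact ⟨a, Finset.mem_union_left _ ha, hav⟩
    · have hv := hsub i hi
      simp only [closedNbhd, Set.mem_iUnion] at hv
      obtain ⟨a, rfl, hav⟩ := hv
      exact ⟨u i, Finset.mem_union_right _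
        (Finset.mem_image_of_mem u (Finset.mem_compl.2 h)), hav⟩
  have hcard := hmin _ hsubQ hdom
  have hunion := Finset.card_union_le A (Sᶜ.image u)
  have himage := Finset.card_image_le (s := Sᶜ) (f := u)
  have hcompl := Finset.card_add_card_compl S
  rw [Fintype.card_fin] at hcompl
  omega
end

section
/- Let G and H be finite simple graphs. Suppose there exists a dominating set D of G □ H of minimum cardinality |D| = γ(G □ H) such that the projection Q = {g ∈ V(G) : (g,h) ∈ D for some h ∈ V(H)} of D onto V(G) is a minimal dominating set of G with respect to containment (i.e., Q dominates G but no proper subset of Q dominates G). Then γ(G □ H) ≥ γ(G)·γ(H). -/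
open SimpleGraph

/-- If removing `q` from the projection of a dominating set `D` of `G □ H` leaves a set that does
not dominate `G`, then the fiber of `D` over `q` dominates `H`. -/
theorem isDominating_fiber {V W : Type*} {G : SimpleGraph V} {H : SimpleGraph W}
    {D : Set (V × W)} (hD : IsDominating (G □ H) D) {q : V}
    (hq : ¬ IsDominating G ((Prod.fst '' D) \ {q})) :
    IsDominating H {h | (q, h) ∈ D} := by
  obtain ⟨v, hv⟩ := not_forall.mp hq
  have eq_of_mem : ∀ a b, (a, b) ∈ D → v = a ∨ G.Adj a v → a = q := fun a b hab hav => by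
    by_contra hne
    exact hv ⟨a, ⟨⟨(a, b), hab, rfl⟩, hne⟩, hav⟩
  intro h
  obtain ⟨⟨a, b⟩, hab, hdom⟩ := hD (v, h)
  simp only [Prod.mk.injEq, boxProd_adj] at hdom
  have haq : a = q := eq_of_mem a b hab (by tauto)
  exact ⟨b, haq ▸ hab, by tauto⟩

theorem vizing_of_minimal_projection {V W : Type*} [Fintype V] [Fintype W]
    (G : SimpleGraph V) (H : SimpleGraph W)
    (hex : ∃ D : Finset (V × W), IsDominating (G □ H) ↑D ∧
      D.card = dominationNumber (V × W) (G □ H) ∧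
      IsDominating G (Prod.fst '' (↑D : Set (V × W))) ∧
      ∀ Q' : Set V, Q' ⊂ Prod.fst '' (↑D : Set (V × W)) → ¬ IsDominating G Q') :
    dominationNumber (V × W) (G □ H) ≥
      dominationNumber V G * dominationNumber W H := by
  classical
  obtain ⟨D, hD, hcard, hdom, hmin⟩ := hex
  have le_image : dominationNumber V G ≤ (D.image Prod.fst).card :=
    dominationNumber_le_card (by rwa [Finset.coe_image])
  have le_fiber : ∀ q ∈ D.image Prod.fst,
      dominationNumber W H ≤ (D.filter fun x => x.1 = q).card := fun q hq => by
    have hfiber := isDominating_fiber hD (hmin _ (Set.sdiff_singleton_ssubset.mpr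
      (by simpa using hq : q ∈ Prod.fst '' (↑D : Set (V × W)))))
    refine (dominationNumber_le_card (D := (D.filter fun x => x.1 = q).image Prod.snd) ?_).trans
      Finset.card_image_le
    convert hfiber using 1
    ext h
    simp
  rw [← hcard, ge_iff_le, Finset.card_eq_sum_card_image Prod.fst D]
  calc dominationNumber V G * dominationNumber W H
      ≤ (D.image Prod.fst).card * dominationNumber W H := Nat.mul_le_mul_right _ le_image
    _ ≤ _ := by simpa using Finset.card_nsmul_le_sum _ _ _ le_fiber
end

section
/- Let P_4 denote the path graph on 4 vertices. Then for G = H = P_4, there is no dominating set D of G □ H of minimum cardinality |D| = γ(G □ H) whose projection Q = {g ∈ V(G) : (g,h) ∈ D for some h ∈ V(H)} onto V(G) is a minimal dominating set of G with respect to containment; that is, for every minimum dominating set D of P_4 □ P_4, some proper subset of the projection of D onto the first factor already dominates P_4. -/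
open SimpleGraph

theorem dominationNumber_pathGraph_four_boxProd_le :
    dominationNumber (Fin 4 × Fin 4) (pathGraph 4 □ pathGraph 4) ≤ 4 := by
  refine dominationNumber_le_card (D := {(0, 1), (1, 3), (2, 0), (3, 2)}) ?_
  simp only [IsDominating, Finset.mem_coe, boxProd_adj, pathGraph_adj]
  decide

/-- Any three vertices of the path on four vertices form a non-minimal dominating set. -/
theorem exists_ssubset_isDominating_pathGraph_four {R : Finset (Fin 4)} (hR : 3 ≤ R.card) :
    ∃ Q ⊂ R, IsDominating (pathGraph 4) (↑Q : Set (Fin 4)) := by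
  simp only [IsDominating, Finset.mem_coe, pathGraph_adj]
  revert R
  decide

/-- A set that contains a full row of `α × Fin n` and meets another row has more than `n`
elements. -/
theorem card_lt_of_row_subset {α : Type*} [DecidableEq α] {n : ℕ} {D : Finset (α × Fin n)}
    {r s : α} (hrow : ∀ j, (r, j) ∈ D) (hs : s ∈ D.image Prod.fst) (hrs : s ≠ r) :
    n < D.card := by
  obtain ⟨⟨_, j⟩, hx, rfl⟩ := Finset.mem_image.1 hs
  have hss : Finset.univ.image (fun k : Fin n => (r, k)) ⊂ D :=
    Finset.ssubset_iff_subset_ne.2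
      ⟨by simpa [Finset.subset_iff] using hrow, fun h => by
        rw [← h] at hx
        simp at hx
        exact hrs hx.symm⟩
  simpa [Finset.card_image_of_injective _ (Prod.mk_right_injective r)] using Finset.card_lt_card hss

/-- A vertex in a row that misses the dominating set is dominated from an adjacent row. -/
theorem exists_adj_mem_of_notMem_image_fst {α β : Type*} [DecidableEq α] {G : SimpleGraph α}
    {H : SimpleGraph β} {D : Finset (α × β)} (hD : IsDominating (G □ H) ↑D) {r : α}
    (hr : r ∉ D.image Prod.fst) (j : β) : ∃ s, G.Adj s r ∧ (s, j) ∈ D := by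
  obtain ⟨⟨s, k⟩, hd, h⟩ := hD (r, j)
  have hsr : s ≠ r := fun h => hr (Finset.mem_image.2 ⟨_, hd, h⟩)
  rcases h with h | h
  · exact absurd (congrArg Prod.fst h).symm hsr
  · rcases boxProd_adj.1 h with ⟨hadj, rfl⟩ | ⟨-, h⟩
    · exact ⟨s, hadj, hd⟩
    · exact absurd h hsr

/-- A dominating set of the four by four grid with at most four vertices meets at least three
rows. -/
theorem three_le_card_image_fst {D : Finset (Fin 4 × Fin 4)}
    (hD : IsDominating (pathGraph 4 □ pathGraph 4) ↑D) (hcard : D.card ≤ 4) :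
    3 ≤ (D.image Prod.fst).card := by
  have row_one (h : 0 ∉ D.image Prod.fst) (j : Fin 4) : (1, j) ∈ D := by
    obtain ⟨s, hs, hmem⟩ := exists_adj_mem_of_notMem_image_fst hD h j
    rw [pathGraph_adj] at hs
    obtain rfl : s = 1 := by clear hmem; revert s; decide
    exact hmem
  have row_two (h : 3 ∉ D.image Prod.fst) (j : Fin 4) : (2, j) ∈ D := by
    obtain ⟨s, hs, hmem⟩ := exists_adj_mem_of_notMem_image_fst hD h j
    rw [pathGraph_adj] at hs
    obtain rfl : s = 2 := by clear hmem; revert s; decide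
    exact hmem
  have row_zero (h₁ : 1 ∉ D.image Prod.fst) (h₂ : 2 ∉ D.image Prod.fst) (j : Fin 4) :
      (0, j) ∈ D := by
    obtain ⟨s, hs, hmem⟩ := exists_adj_mem_of_notMem_image_fst hD h₁ j
    have hs₂ : s ≠ 2 := by
      rintro rfl
      exact h₂ (Finset.mem_image_of_mem Prod.fst hmem)
    rw [pathGraph_adj] at hs
    obtain rfl : s = 0 := by clear hmem; revert s; decide
    exact hmem
  have mem_image {r j : Fin 4} (h : (r, j) ∈ D) : r ∈ D.image Prod.fst :=
    Finset.mem_image_of_mem Prod.fst h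
  by_cases h₀ : 0 ∈ D.image Prod.fst
  · by_cases h₃ : 3 ∈ D.image Prod.fst
    · by_contra hlt
      have hmiss : ∀ R : Finset (Fin 4), 0 ∈ R → 3 ∈ R → ¬ 3 ≤ R.card → 1 ∉ R ∧ 2 ∉ R := by
        decide
      obtain ⟨h₁, h₂⟩ := hmiss _ h₀ h₃ hlt
      exact absurd (card_lt_of_row_subset (row_zero h₁ h₂) h₃ (by decide)) hcard.not_gt
    · exact absurd (card_lt_of_row_subset (row_two h₃) h₀ (by decide)) hcard.not_gt
  · have h₂₃ : 2 ∈ D.image Prod.fst ∨ 3 ∈ D.image Prod.fst := by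
      by_cases h₃ : 3 ∈ D.image Prod.fst
      · exact Or.inr h₃
      · exact Or.inl (mem_image (row_two h₃ 0))
    rcases h₂₃ with h | h <;>
      exact absurd (card_lt_of_row_subset (row_one h₀) h (by decide)) hcard.not_gt

theorem p4_no_minimal_projection :
    ∀ D : Finset (Fin 4 × Fin 4),
      IsDominating (pathGraph 4 □ pathGraph 4) ↑D →
      D.card = dominationNumber (Fin 4 × Fin 4) (pathGraph 4 □ pathGraph 4) →
      ∃ Q' : Set (Fin 4), Q' ⊂ Prod.fst '' (↑D : Set (Fin 4 × Fin 4)) ∧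
        IsDominating (pathGraph 4) Q' := by
  intro D hD hcard
  obtain ⟨Q, hQ, hdom⟩ := exists_ssubset_isDominating_pathGraph_four
    (three_le_card_image_fst hD (hcard.trans_le dominationNumber_pathGraph_four_boxProd_le))
  refine ⟨↑Q, ?_, hdom⟩
  rw [← Finset.coe_image]
  exact Finset.coe_ssubset.2 hQ
end
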